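/- The Diophantine equation 5^x − 2^x = L_r in nonnegative integers r, x has only the solution (r, x) = (2, 1). -/

import Mathlib

/-- The Lucas sequence: `L 0 = 2`, `L 1 = 1`, `L (n+2) = L (n+1) + L n`. -/
def lucas : ℕ → ℕ
  | 0 => 2
  | 1 => 1
  | n + 2 => lucas (n + 1) + lucas n

theorem lucas_add_two (n : ℕ) : lucas (n + 2) = lucas (n + 1) + lucas n := by
  rw [lucas]

theorem lucas_add_twentyfour (n : ℕ) :
    lucas (n + 24) = 46368 * lucas (n + 1) + 28657 * lucas n := by
  simp only [lucas_add_two]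
  ring

/-- Modulo `12` the Lucas sequence has period `24` and avoids the residue class of `9`. -/
theorem lucas_mod_twelve_ne_nine (n : ℕ) : lucas n % 12 ≠ 9 := by
  induction n using Nat.strong_induction_on with
  | _ n ih =>
    by_cases hn : n < 24
    · interval_cases n <;> simp [lucas]
    · obtain ⟨m, rfl⟩ := Nat.exists_eq_add_of_le' (not_lt.mp hn)
      have := ih m (by omega)
      rw [lucas_add_twentyfour]
      omega

theorem four_le_lucas_add_three (n : ℕ) : 4 ≤ lucas (n + 3) := by
  induction n with
  | zero => simp [lucas]
  | succ n ih =>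
    rw [show n + 1 + 3 = n + 2 + 2 by ring, lucas_add_two]
    exact ih.trans (Nat.le_add_right _ _)

theorem lucas_pos (n : ℕ) : 0 < lucas n := by
  match n with
  | 0 | 1 | 2 => simp [lucas]
  | n + 3 => exact (by norm_num : 0 < 4).trans_le (four_le_lucas_add_three n)

theorem lucas_eq_three_iff (n : ℕ) : lucas n = 3 ↔ n = 2 := by
  match n with
  | 0 | 1 | 2 => simp [lucas]
  | n + 3 =>
    have := four_le_lucas_add_three n
    omega

theorem five_pow_sub_two_pow_emod_twelve (n : ℕ) :
    ((5 : ℤ) ^ (n + 2) - 2 ^ (n + 2)) % 12 = 9 := by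
  have h : (5 : ℤ) ^ (n + 2) % 12 = 1 ∧ (2 : ℤ) ^ (n + 2) % 12 = 4 ∨
      (5 : ℤ) ^ (n + 2) % 12 = 5 ∧ (2 : ℤ) ^ (n + 2) % 12 = 8 := by
    induction n with
    | zero => norm_num
    | succ n ih =>
      rw [show n + 1 + 2 = n + 2 + 1 by ring, pow_succ (5 : ℤ), pow_succ (2 : ℤ)]
      omega
  omega

theorem five_pow_sub_two_pow_eq_lucas (r x : ℕ) :
    (5 : ℤ) ^ x - 2 ^ x = lucas r ↔ (r, x) = (2, 1) := by
  match x with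
  | 0 =>
    have := lucas_pos r
    simp only [pow_zero, sub_self, Prod.mk.injEq]
    omega
  | 1 =>
    have := lucas_eq_three_iff r
    simp only [pow_one, Prod.mk.injEq, and_true]
    omega
  | x + 2 =>
    have := five_pow_sub_two_pow_emod_twelve x
    have := lucas_mod_twelve_ne_nine r
    simp only [Prod.mk.injEq]
    omega
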